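/- Let W be a subspace of V. Then V is the internal direct sum of W and its formal-basis-style complement: W ∩ C(W) = {0} and W + C(W) = V. -/

import Mathlib

/-- The index set `S(W)` of the formal-basis-style complement, defined by strong
recursion: `n ∈ S(W)` iff `e n ∉ W + span {e k : k ∈ S(W), k < n}`. -/
noncomputable def formalBasisIndexSet {𝔽 V : Type*} [Field 𝔽] [AddCommGroup V] [Module 𝔽 V]
    (e : ℕ → V) (W : Submodule 𝔽 V) (n : ℕ) : Prop :=
  Nat.strongRecOn (motive := fun _ => Prop) n (fun n ih =>
    e n ∉ W ⊔ Submodule.span 𝔽 {v | ∃ k, ∃ h : k < n, ih k h ∧ v = e k})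

/-- The formal-basis-style complement `C(W) = span {e n : n ∈ S(W)}`. -/
noncomputable def formalBasisComplement {𝔽 V : Type*} [Field 𝔽] [AddCommGroup V] [Module 𝔽 V]
    (e : ℕ → V) (W : Submodule 𝔽 V) : Submodule 𝔽 V :=
  Submodule.span 𝔽 (e '' {n | formalBasisIndexSet e W n})

/-- The defining recursion of the index set. -/
theorem formalBasisIndexSet_iff {𝔽 V : Type*} [Field 𝔽] [AddCommGroup V] [Module 𝔽 V]
    (e : ℕ → V) (W : Submodule 𝔽 V) (n : ℕ) :
    formalBasisIndexSet e W n ↔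
      e n ∉ W ⊔ Submodule.span 𝔽 (e '' {k | k < n ∧ formalBasisIndexSet e W k}) := by
  have hset : e '' {k | k < n ∧ formalBasisIndexSet e W k} =
      {v | ∃ k, ∃ _ : k < n, formalBasisIndexSet e W k ∧ v = e k} := by
    ext v
    simp only [Set.mem_image, Set.mem_ofPred_eq, exists_prop, and_assoc, eq_comm (a := v)]
  rw [hset]
  conv_lhs => rw [formalBasisIndexSet, Nat.strongRecOn_eq]
  rfl

/-- `W` is disjoint from each finite stage of its formal-basis-style complement. -/
theorem disjoint_span_formalBasisIndexSet_lt {𝔽 V : Type*} [Field 𝔽] [AddCommGroup V]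
    [Module 𝔽 V] (e : ℕ → V) (W : Submodule 𝔽 V) (n : ℕ) :
    Disjoint W (Submodule.span 𝔽 (e '' {k | k < n ∧ formalBasisIndexSet e W k})) := by
  induction n with
  | zero => simp
  | succ n ih =>
    by_cases hn : formalBasisIndexSet e W n
    · have hset : {k | k < n + 1 ∧ formalBasisIndexSet e W k} =
          {k | k < n ∧ formalBasisIndexSet e W k} ∪ {n} := by
        ext k
        simp only [Set.mem_ofPred_eq, Set.mem_union, Set.mem_singleton_iff]
        grind
      rw [hset, Set.image_union, Set.image_singleton, Submodule.span_union]
      exact ih.disjoint_sup_right_of_disjoint_sup_left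
        (Submodule.disjoint_span_singleton_of_notMem ((formalBasisIndexSet_iff e W n).1 hn))
    · have hset : {k | k < n + 1 ∧ formalBasisIndexSet e W k} =
          {k | k < n ∧ formalBasisIndexSet e W k} := by
        ext k
        simp only [Set.mem_ofPred_eq]
        grind
      rwa [hset]

/-- The formal-basis-style complement is the union of its finite stages. -/
theorem formalBasisComplement_eq_iSup {𝔽 V : Type*} [Field 𝔽] [AddCommGroup V] [Module 𝔽 V]
    (e : ℕ → V) (W : Submodule 𝔽 V) :
    formalBasisComplement e W =
      ⨆ n, Submodule.span 𝔽 (e '' {k | k < n ∧ formalBasisIndexSet e W k}) := by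
  rw [formalBasisComplement, ← Submodule.span_iUnion, ← Set.image_iUnion]
  congr 2
  ext k
  simp only [Set.mem_ofPred_eq, Set.mem_iUnion]
  exact ⟨fun hk => ⟨k + 1, k.lt_succ_self, hk⟩, fun ⟨_, _, hk⟩ => hk⟩

/-- Every `e n` lies in the sum of `W` and its formal-basis-style complement. -/
theorem mem_sup_formalBasisComplement {𝔽 V : Type*} [Field 𝔽] [AddCommGroup V] [Module 𝔽 V]
    (e : ℕ → V) (W : Submodule 𝔽 V) (n : ℕ) : e n ∈ W ⊔ formalBasisComplement e W := by
  by_cases hn : formalBasisIndexSet e W n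
  · exact Submodule.mem_sup_right (Submodule.subset_span ⟨n, hn, rfl⟩)
  · rw [formalBasisIndexSet_iff, not_not] at hn
    exact sup_le_sup_left (Submodule.span_mono (Set.image_mono fun _ hk => hk.2)) W hn

/-- `V` is the internal direct sum of `W` and its formal-basis-style complement. -/
theorem formalBasisComplement_isCompl {𝔽 V : Type*} [Field 𝔽] [AddCommGroup V] [Module 𝔽 V]
    (b : Module.Basis ℕ 𝔽 V) (W : Submodule 𝔽 V) :
    W ⊓ formalBasisComplement ⇑b W = ⊥ ∧ W ⊔ formalBasisComplement ⇑b W = ⊤ := by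
  constructor
  · rw [← disjoint_iff, formalBasisComplement_eq_iSup, Submodule.disjoint_def]
    intro x hxW hx
    have hmono : Monotone fun n =>
        Submodule.span 𝔽 (⇑b '' {k | k < n ∧ formalBasisIndexSet (⇑b) W k}) :=
      fun _ _ hmn => Submodule.span_mono
        (Set.image_mono fun _ hk => ⟨hk.1.trans_le hmn, hk.2⟩)
    obtain ⟨n, hn⟩ := (Submodule.mem_iSup_of_directed _ hmono.directed_le).1 hx
    exact Submodule.disjoint_def.1 (disjoint_span_formalBasisIndexSet_lt (⇑b) W n) x hxW hn
  · rw [eq_top_iff, ← b.span_eq, Submodule.span_le]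
    rintro _ ⟨n, rfl⟩
    exact mem_sup_formalBasisComplement (⇑b) W n
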